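/- Let G and H be primitive graphs and P : E_G × E_H → ℤ a payoff function. Then there exist one-sided infinite walks p ∈ W_∞(H) and q ∈ W_∞(G) and k ∈ ℕ with k ≥ 1 such that p_{n+k} = p_n and q_{n+k} = q_n for all n ∈ ℕ, and: (1) lim_{n→∞} (1/n)·Σ_{i=1}^n P(q_i, p_i) = V(G,H,P); (2) for every q̃ ∈ W_∞(G), liminf_{n→∞} (1/n)·Σ_{i=1}^n P(q̃_i, p_i) ≥ V(G,H,P); and (3) for every p̃ ∈ W_∞(H) there exists q̃ ∈ W_∞(G) such that limsup_{n→∞} (1/n)·Σ_{i=1}^n P(q̃_i, p̃_i) ≤ V(G,H,P). -/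

import Mathlib

open Filter Set

structure DirGraph (V E : Type) where
  src : E → V
  tgt : E → V

namespace DirGraph

variable {V E : Type}

/-- A (finite) walk: consecutive edges are compatible. -/
def IsWalkList (G : DirGraph V E) (p : List E) : Prop :=
  p.Chain' fun e f => G.tgt e = G.src f

/-- The set of walks of length `n`. -/
def walks (G : DirGraph V E) (n : ℕ) : Set (List E) :=
  {p | p.length = n ∧ G.IsWalkList p}

/-- The set of walks of length `n` from `v` to `w`. -/
def walksFT (G : DirGraph V E) (n : ℕ) (v w : V) : Set (List E) :=
  {p | p.length = n ∧ G.IsWalkList p ∧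
    ∃ h : p ≠ [], G.src (p.head h) = v ∧ G.tgt (p.getLast h) = w}

def IsCycle (G : DirGraph V E) (p : List E) : Prop :=
  G.IsWalkList p ∧ ∃ h : p ≠ [], G.src (p.head h) = G.tgt (p.getLast h)

def Irreducible (G : DirGraph V E) : Prop :=
  ∀ v w : V, ∃ n : ℕ, (G.walksFT n v w).Nonempty

/-- Irreducible and the gcd of all cycle lengths is 1 (every common divisor of
the cycle lengths equals 1). -/
def Primitive (G : DirGraph V E) : Prop :=
  G.Irreducible ∧ ∀ d : ℕ, (∀ p, G.IsCycle p → d ∣ p.length) → d = 1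

end DirGraph

/-- `Σ_i P(q_i, p_i)`. -/
def payoffSum {EG EH : Type} (P : EG → EH → ℤ) (q : List EG) (p : List EH) : ℤ :=
  (List.zipWith P q p).sum

/-- `V_n(G,H,P) = max_{p ∈ W_n(H)} min_{q ∈ W_n(G)} Σ P(q_i,p_i)`. -/
noncomputable def Vn {VG EG VH EH : Type} (G : DirGraph VG EG) (H : DirGraph VH EH)
    (P : EG → EH → ℤ) (n : ℕ) : ℤ :=
  sSup ((fun p => sInf ((fun q => payoffSum P q p) '' G.walks n)) '' H.walks n)

/-- `M(p)(v,w) = inf {Σ P(q_i,p_i) : q ∈ W_n(G, v → w)}`, with `inf ∅ = ⊤`. -/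
noncomputable def Mfun {VG EG EH : Type} (G : DirGraph VG EG) (P : EG → EH → ℤ)
    (p : List EH) : VG → VG → WithTop ℤ :=
  fun v w => sInf ((fun q => ((payoffSum P q p : ℤ) : WithTop ℤ)) '' G.walksFT p.length v w)

/-- `f < g` pointwise everywhere. -/
def StrictDom {V α : Type} [LT α] (f g : V → V → α) : Prop := ∀ v w, f v w < g v w

/-- `<`-maximal elements of a set w.r.t. a strict domination relation. -/
def maxElems {α : Type} (lt : α → α → Prop) (A : Set α) : Set α :=
  {f ∈ A | ¬ ∃ g ∈ A, lt f g}

/-- Tropical convolution on `(ℤ ∪ {∞})`-valued matrices. -/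
noncomputable def tconv {V : Type} (f g : V → V → WithTop ℤ) : V → V → WithTop ℤ :=
  fun u w => sInf (Set.range fun v => f u v + g v w)

/-- Tropical convolution on `ℤ`-valued matrices. -/
noncomputable def tconvZ {V : Type} (f g : V → V → ℤ) : V → V → ℤ :=
  fun u w => sInf (Set.range fun v => f u v + g v w)

/-- Non-improvable walks in `H` (of any length). -/
noncomputable def walksDagger {VG EG VH EH : Type} (G : DirGraph VG EG) (H : DirGraph VH EH)
    (P : EG → EH → ℤ) : Set (List EH) :=
  {p | ∃ u v : VH, p ∈ H.walksFT p.length u v ∧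
    Mfun G P p ∈ maxElems StrictDom (Mfun G P '' H.walksFT p.length u v)}

/-- The edge shift of a graph. -/
def XEdge {V E : Type} (G : DirGraph V E) : Set (ℤ → E) :=
  {x | ∀ n : ℤ, G.tgt (x n) = G.src (x (n + 1))}

/-- The word `x_{[m,n]}` as a list (of length `n - m + 1` when `m ≤ n`). -/
def seg {A : Type} (x : ℤ → A) (m n : ℤ) : List A :=
  List.ofFn fun i : Fin (n + 1 - m).toNat => x (m + i)

/-- `X_H^†`: points all of whose subwords are non-improvable walks. -/
noncomputable def XHdag {VG EG VH EH : Type} (G : DirGraph VG EG) (H : DirGraph VH EH)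
    (P : EG → EH → ℤ) : Set (ℤ → EH) :=
  {x | x ∈ XEdge H ∧ ∀ m n : ℤ, m ≤ n → seg x m n ∈ walksDagger G H P}

/-- `R(p)`: optimal responses to `p`. -/
noncomputable def Rset {VG EG EH : Type} (G : DirGraph VG EG) (P : EG → EH → ℤ)
    (p : List EH) : Set (List EG) :=
  {q | ∃ v w : VG, q ∈ G.walksFT p.length v w ∧
    ((payoffSum P q p : ℤ) : WithTop ℤ) = Mfun G P p v w}

/-- A one-sided infinite walk in a graph. -/
def IsInfWalk {V E : Type} (G : DirGraph V E) (p : ℕ → E) : Prop :=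
  ∀ n : ℕ, G.tgt (p n) = G.src (p (n + 1))

namespace DirGraph

variable {V E : Type}

/-- `G` has a walk of length `n` (possibly zero) from `v` to `w`. -/
def Reach (G : DirGraph V E) : ℕ → V → V → Prop
  | 0, v, w => v = w
  | n + 1, v, w => ∃ e, G.src e = v ∧ G.Reach n (G.tgt e) w

theorem Reach.trans {G : DirGraph V E} {m n : ℕ} {u v w : V} (h : G.Reach m u v)
    (h' : G.Reach n v w) : G.Reach (m + n) u w := by
  induction m generalizing u with
  | zero => obtain rfl : u = v := h; simpa using h'
  | succ m ih =>
    obtain ⟨e, he, h⟩ := h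
    rw [Nat.succ_add]
    exact ⟨e, he, ih h⟩

theorem IsWalkList.reach {G : DirGraph V E} {l : List E} (hl : G.IsWalkList l) (hne : l ≠ []) :
    G.Reach l.length (G.src (l.head hne)) (G.tgt (l.getLast hne)) := by
  induction l with
  | nil => exact absurd rfl hne
  | cons a l ih =>
    refine ⟨a, rfl, ?_⟩
    rcases l with _ | ⟨b, l⟩
    · rfl
    · have h := List.isChain_cons_cons.1 hl
      simpa [h.1] using ih h.2 (by simp)

namespace Irreducible

variable {G : DirGraph V E}

theorem exists_reach (h : G.Irreducible) (v w : V) : ∃ n, G.Reach n v w := by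
  obtain ⟨n, l, rfl, hl, hne, rfl, rfl⟩ := h v w
  exact ⟨_, hl.reach hne⟩

theorem src_surjective (h : G.Irreducible) : Function.Surjective G.src := fun v => by
  obtain ⟨n, l, -, -, hne, hv, -⟩ := h v v
  exact ⟨_, hv⟩

theorem tgt_surjective (h : G.Irreducible) : Function.Surjective G.tgt := fun v => by
  obtain ⟨n, l, -, -, hne, -, hv⟩ := h v v
  exact ⟨_, hv⟩

end Irreducible

namespace Primitive

variable {G : DirGraph V E}

theorem nonempty (h : G.Primitive) : Nonempty V := by
  by_contra hV
  have := h.2 0 fun p hp => by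
    obtain ⟨-, hne, -⟩ := hp
    exact (hV ⟨G.src (p.head hne)⟩).elim
  omega

/-- A primitive graph has a length for which every pair of vertices is joined by a walk. -/
theorem exists_forall_reach [Finite V] (h : G.Primitive) : ∃ n, ∀ v w, G.Reach n v w := by
  obtain ⟨v₀⟩ := h.nonempty
  let L : AddSubmonoid ℕ :=
    { carrier := {n | G.Reach n v₀ v₀}
      zero_mem' := rfl
      add_mem' := fun h h' => h.trans h' }
  have hgcd : Nat.setGcd (L : Set ℕ) = 1 := by
    refine h.2 _ fun p hp => ?_
    obtain ⟨hl, hne, hcyc⟩ := hp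
    have hc := hl.reach hne
    rw [← hcyc] at hc
    obtain ⟨a, ha⟩ := h.1.exists_reach v₀ (G.src (p.head hne))
    obtain ⟨b, hb⟩ := h.1.exists_reach (G.src (p.head hne)) v₀
    have h₁ : a + b ∈ (L : Set ℕ) := ha.trans hb
    have h₂ : a + p.length + b ∈ (L : Set ℕ) := (ha.trans hc).trans hb
    refine (Nat.dvd_add_right (Nat.setGcd_dvd_of_mem h₁)).1 ?_
    convert Nat.setGcd_dvd_of_mem h₂ using 1
    ring
  obtain ⟨n₀, hn₀⟩ := Nat.exists_mem_closure_of_ge (L : Set ℕ)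
  have hL : ∀ m ≥ n₀, G.Reach m v₀ v₀ := fun m hm => by
    have := hn₀ m hm (by simp [hgcd])
    rwa [AddSubmonoid.closure_eq] at this
  choose a ha using fun v => h.1.exists_reach v v₀
  choose b hb using h.1.exists_reach v₀
  obtain ⟨A, hA⟩ := (Set.finite_range a).bddAbove
  obtain ⟨B, hB⟩ := (Set.finite_range b).bddAbove
  refine ⟨n₀ + A + B, fun v w => ?_⟩
  have hAv : a v ≤ A := hA ⟨v, rfl⟩
  have hBw : b w ≤ B := hB ⟨w, rfl⟩
  have := ((ha v).trans (hL (n₀ + A + B - a v - b w) (by omega))).trans (hb w)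
  rwa [show a v + (n₀ + A + B - a v - b w) + b w = n₀ + A + B by omega] at this

end Primitive

end DirGraph

section InfWalk

variable {V E : Type} {G : DirGraph V E}

theorem exists_isInfWalk (hG : Function.Surjective G.src) (v : V) :
    ∃ x, IsInfWalk G x ∧ G.src (x 0) = v := by
  choose nxt hnxt using hG
  refine ⟨fun n => nxt ((G.tgt ∘ nxt)^[n] v), fun n => ?_, hnxt v⟩
  simp only [hnxt, Function.iterate_succ_apply', Function.comp_apply]

/-- Finite walks extend to infinite walks. -/
theorem exists_isInfWalk_extending (hG : Function.Surjective G.src) (l : List E)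
    (hl : G.IsWalkList l) (v : V) (hv : ∀ e ∈ l.head?, G.src e = v) :
    ∃ x, IsInfWalk G x ∧ G.src (x 0) = v ∧ ∀ i (h : i < l.length), l[i] = x i := by
  induction l generalizing v with
  | nil =>
    obtain ⟨x, hx, hx0⟩ := exists_isInfWalk hG v
    exact ⟨x, hx, hx0, fun i h => absurd h (by simp)⟩
  | cons a l ih =>
    obtain ⟨hal, hl⟩ := List.isChain_cons.1 hl
    obtain ⟨x, hx, hx0, hxl⟩ := ih hl (G.tgt a) fun e he => (hal e he).symm
    refine ⟨fun n => Nat.casesOn n a x, ?_, hv a rfl, ?_⟩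
    · rintro (_ | n)
      · exact hx0.symm
      · exact hx n
    · rintro (_ | n) h
      · rfl
      · exact hxl n (by simpa using h)

theorem IsInfWalk.ofFn_mem_walks {x : ℕ → E} (hx : IsInfWalk G x) (n : ℕ) :
    List.ofFn (fun i : Fin n => x i) ∈ G.walks n := by
  refine ⟨by simp, List.isChain_iff_getElem.2 fun i hi => ?_⟩
  simpa using hx i

theorem Nat.succ_mod_cases {k : ℕ} (hk : 0 < k) (n : ℕ) :
    (n + 1) % k = n % k + 1 ∨ n % k + 1 = k ∧ (n + 1) % k = 0 := by
  have h := Nat.mod_lt n hk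
  have hn := Nat.div_add_mod n k
  rcases Nat.lt_or_ge (n % k + 1) k with h' | h'
  · left
    rw [← hn, add_assoc, Nat.mul_add_mod, Nat.mul_add_mod, Nat.mod_mod, Nat.mod_eq_of_lt h']
  · right
    have h'' : n % k + 1 = k := by omega
    refine ⟨h'', ?_⟩
    rw [← hn, add_assoc, h'', Nat.mul_add_mod, Nat.mod_self]

/-- Repeating a closed segment of an infinite walk gives an infinite walk. -/
theorem IsInfWalk.loop {x : ℕ → E} (hx : IsInfWalk G x) {i k : ℕ} (hk : 0 < k)
    (h : G.src (x i) = G.src (x (i + k))) : IsInfWalk G fun n => x (i + n % k) := by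
  intro n
  have hn := hx (i + n % k)
  rcases Nat.succ_mod_cases hk n with hmod | ⟨hlast, hmod⟩
  · simpa only [hmod, ← add_assoc] using hn
  · simp only [hmod, add_zero]
    rw [h, hn, add_assoc, hlast]

/-- Removing a closed segment of an infinite walk gives an infinite walk. -/
theorem IsInfWalk.excise {x : ℕ → E} (hx : IsInfWalk G x) {i k : ℕ}
    (h : G.src (x i) = G.src (x (i + k))) :
    IsInfWalk G fun n => if n < i then x n else x (n + k) := by
  intro n
  have hn := hx n
  rcases lt_trichotomy (n + 1) i with h' | h' | h'
  · simpa [h', show n < i by omega] using hn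
  · subst h'
    simpa [← h] using hn
  · have hnk := hx (n + k)
    simp only [show ¬ n < i by omega, show ¬ n + 1 < i by omega, if_false]
    rw [hnk, add_right_comm]

theorem sum_range_excise (f : ℕ → ℤ) (i k t : ℕ) :
    ∑ m ∈ Finset.range (i + k + t), f m =
      ∑ m ∈ Finset.range (i + t), f (if m < i then m else m + k) +
        ∑ m ∈ Finset.range k, f (i + m) := by
  rw [Finset.sum_range_add f (i + k) t, Finset.sum_range_add f i k, Finset.sum_range_add _ i t]
  have h₁ : ∑ m ∈ Finset.range i, f (if m < i then m else m + k) = ∑ m ∈ Finset.range i, f m :=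
    Finset.sum_congr rfl fun m hm => by rw [if_pos (Finset.mem_range.1 hm)]
  have h₂ : ∀ m, f (if i + m < i then i + m else i + m + k) = f (i + k + m) := fun m => by
    rw [if_neg (by omega), add_right_comm]
  simp only [h₁, h₂]
  ring

theorem exists_src_eq [Finite V] (x : ℕ → E) (G : DirGraph V E) :
    ∃ i k, 0 < k ∧ i + k ≤ Nat.card V ∧ G.src (x i) = G.src (x (i + k)) := by
  have := Fintype.ofFinite V
  obtain ⟨a, b, hab, h⟩ := Fintype.exists_ne_map_eq_of_card_lt
    (fun i : Fin (Nat.card V + 1) => G.src (x i)) (by simp)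
  rcases lt_or_gt_of_ne hab with hlt | hlt
  · refine ⟨a, b - a, by omega, by omega, ?_⟩
    rwa [Nat.add_sub_cancel' hlt.le]
  · refine ⟨b, a - b, by omega, by omega, ?_⟩
    rw [Nat.add_sub_cancel' hlt.le]
    exact h.symm

theorem exists_abs_sum_sub_le_of_periodic {x : ℕ → ℤ} {k : ℕ} {μ : ℝ} (hk : 0 < k)
    (hx : ∀ n, x (n + k) = x n) (hμ : ((∑ i ∈ Finset.range k, x i : ℤ) : ℝ) = k * μ) :
    ∃ D : ℝ, ∀ n : ℕ, |((∑ i ∈ Finset.range n, x i : ℤ) : ℝ) - n * μ| ≤ D := by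
  set d : ℕ → ℝ := fun n => ((∑ i ∈ Finset.range n, x i : ℤ) : ℝ) - n * μ with hd
  have hper : Function.Periodic d k := fun n => by
    induction n with
    | zero => simp only [hd, zero_add, hμ]; simp
    | succ n ih =>
      simp only [hd] at ih ⊢
      rw [Nat.succ_add, Finset.sum_range_succ, Finset.sum_range_succ, hx]
      push_cast at ih ⊢
      linarith
  refine ⟨∑ j ∈ Finset.range k, |d j|, fun n => ?_⟩
  change |d n| ≤ _
  rw [← hper.map_mod_nat n]
  exact Finset.single_le_sum (f := fun j => |d j|) (fun _ _ => abs_nonneg _)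
    (Finset.mem_range.2 (Nat.mod_lt n hk))

/-- In a finite weighted graph some periodic walk attains the maximal mean weight, and all walks
obey the resulting bound up to a constant. -/
theorem exists_periodic_maximal_mean [Finite V] (G : DirGraph V E) (r : E → ℤ) (R : ℕ)
    (hr : ∀ e, |r e| ≤ R) (hG : ∃ x, IsInfWalk G x) :
    ∃ (μ : ℝ) (k : ℕ) (x : ℕ → E), 0 < k ∧ IsInfWalk G x ∧ (∀ n, x (n + k) = x n) ∧
      ((∑ i ∈ Finset.range k, r (x i) : ℤ) : ℝ) = k * μ ∧
      ∃ K : ℝ, ∀ y, IsInfWalk G y → ∀ n : ℕ,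
        ((∑ i ∈ Finset.range n, r (y i) : ℤ) : ℝ) ≤ n * μ + K := by
  set c := Nat.card V
  let S : Set (ℕ × ℤ) := {s | ∃ x : ℕ → E, IsInfWalk G x ∧ (∀ n, x (n + s.1) = x n) ∧
    0 < s.1 ∧ s.1 ≤ c ∧ ∑ i ∈ Finset.range s.1, r (x i) = s.2}
  have hsum : ∀ (y : ℕ → E) (n : ℕ), |∑ i ∈ Finset.range n, r (y i)| ≤ n * R := fun y n =>
    (Finset.abs_sum_le_sum_abs _ _).trans <| by
      simpa using Finset.sum_le_card_nsmul (Finset.range n) (fun i => |r (y i)|) R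
        fun i _ => hr _
  have hSfin : S.Finite := by
    refine ((Set.finite_Icc 0 c).prod (Set.finite_Icc (-(c * R : ℤ)) (c * R))).subset ?_
    rintro ⟨k, s⟩ ⟨x, -, -, hk, hkc, hs⟩
    refine ⟨⟨hk.le, hkc⟩, abs_le.1 ?_⟩
    simp only at hs hkc ⊢
    rw [← hs]
    exact (hsum x k).trans (by gcongr)
  have hloop : ∀ y, IsInfWalk G y → ∀ i k, 0 < k → i + k ≤ c →
      G.src (y i) = G.src (y (i + k)) → (k, ∑ m ∈ Finset.range k, r (y (i + m))) ∈ S := by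
    intro y hy i k hk hik h
    refine ⟨_, hy.loop hk h, fun n => by simp, hk, by simp only; omega, ?_⟩
    exact Finset.sum_congr rfl fun m hm => by
      rw [Nat.mod_eq_of_lt (Finset.mem_range.1 hm)]
  have hSne : S.Nonempty := by
    obtain ⟨x, hx⟩ := hG
    obtain ⟨i, k, hk, hik, h⟩ := exists_src_eq x G
    exact ⟨_, hloop x hx i k hk hik h⟩
  obtain ⟨⟨k, s⟩, ⟨x, hx, hxk, hk, hkc, hs⟩, hmax⟩ :=
    Set.exists_max_image S (fun s => (s.2 : ℝ) / s.1) hSfin hSne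
  simp only at hxk hk hkc hs hmax
  have hk' : (0 : ℝ) < k := by exact_mod_cast hk
  set μ : ℝ := s / k with hμ
  refine ⟨μ, k, x, hk, hx, hxk, by rw [hs, hμ]; field_simp, c * R + c * |μ|, ?_⟩
  intro y hy n
  induction n using Nat.strong_induction_on generalizing y with
  | _ n ih =>
    rcases le_or_gt n c with hn | hn
    · have h₁ : ((∑ i ∈ Finset.range n, r (y i) : ℤ) : ℝ) ≤ n * R := by
        exact_mod_cast (le_abs_self _).trans (hsum y n)
      have hn' : (n : ℝ) ≤ c := by exact_mod_cast hn
      have h₂ : (n : ℝ) * R ≤ c * R := by gcongr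
      have h₃ : (n : ℝ) * |μ| ≤ c * |μ| := by gcongr
      have h₄ : -((n : ℝ) * |μ|) ≤ n * μ := by
        rw [← mul_neg]
        exact mul_le_mul_of_nonneg_left (neg_abs_le μ) (by positivity)
      linarith
    · obtain ⟨i, d, hd, hid, h⟩ := exists_src_eq y G
      obtain ⟨t, rfl⟩ : ∃ t, n = i + d + t := Nat.exists_eq_add_of_le (by omega)
      have h₁ := ih (i + t) (by omega) _ (hy.excise h)
      have h₂ := hmax _ (hloop y hy i d hd hid h)
      have hd' : (0 : ℝ) < d := by exact_mod_cast hd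
      rw [div_le_iff₀ hd'] at h₂
      rw [sum_range_excise (fun m => r (y m))]
      simp only [← apply_ite y] at h₁
      push_cast at h₁ h₂ ⊢
      linarith

end InfWalk

section Cost

variable {VG EG VH EH : Type} {G : DirGraph VG EG} {P : EG → EH → ℤ}

/-- The cheapest way of arriving at `v` against the edge `b`, given the costs `f` of arriving at
each vertex beforehand. -/
noncomputable def stepCost (G : DirGraph VG EG) (P : EG → EH → ℤ) (f : VG → ℤ) (b : EH) (v : VG) :
    ℤ :=
  sInf ((fun a => f (G.src a) + P a b) '' {a | G.tgt a = v})

/-- The minimal cost against `p` of walks of length `n` with prescribed final vertex, where `f` is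
the cost of the initial vertex. -/
noncomputable def cost (G : DirGraph VG EG) (P : EG → EH → ℤ) (p : ℕ → EH) (f : VG → ℤ) :
    ℕ → VG → ℤ
  | 0 => f
  | n + 1 => stepCost G P (cost G P p f n) (p n)

section Step

variable [Finite EG]

theorem stepCost_le (f : VG → ℤ) (b : EH) (a : EG) :
    stepCost G P f b (G.tgt a) ≤ f (G.src a) + P a b :=
  csInf_le (Set.toFinite _).bddBelow ⟨a, rfl, rfl⟩

variable (hG : Function.Surjective G.tgt)
include hG

theorem exists_stepCost_eq (P : EG → EH → ℤ) (f : VG → ℤ) (b : EH) (v : VG) :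
    ∃ a, G.tgt a = v ∧ stepCost G P f b v = f (G.src a) + P a b := by
  obtain ⟨a₀, ha₀⟩ := hG v
  have hne : ((fun a => f (G.src a) + P a b) '' {a | G.tgt a = v}).Nonempty := ⟨_, a₀, ha₀, rfl⟩
  obtain ⟨a, ha, h⟩ := hne.csInf_mem (Set.toFinite _)
  exact ⟨a, ha, h.symm⟩

theorem stepCost_add_const (f : VG → ℤ) (c : ℤ) (b : EH) (v : VG) :
    stepCost G P (fun u => f u + c) b v = stepCost G P f b v + c := by
  obtain ⟨a, rfl, ha⟩ := exists_stepCost_eq hG P f b v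
  obtain ⟨a', haa', ha'⟩ := exists_stepCost_eq hG P (fun u => f u + c) b (G.tgt a)
  have h := stepCost_le (G := G) (P := P) (fun u => f u + c) b a
  have h' := stepCost_le (G := G) (P := P) f b a'
  rw [haa'] at h'
  linarith

theorem cost_add_le {C : ℤ} (hC : ∀ a b, |P a b| ≤ C) (p : ℕ → EH) (f : VG → ℤ) {n : ℕ} {c : ℤ}
    (h : ∀ u, cost G P p f n u ≤ c) (m : ℕ) (v : VG) : cost G P p f (n + m) v ≤ c + m * C := by
  induction m generalizing v with
  | zero => simpa using h v
  | succ m ih =>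
    obtain ⟨a, rfl⟩ := hG v
    have h₁ := stepCost_le (G := G) (P := P) (cost G P p f (n + m)) (p (n + m)) a
    have h₂ := (abs_le.1 (hC a (p (n + m)))).2
    have h₃ := ih (G.src a)
    rw [← add_assoc]
    push_cast
    change stepCost _ _ _ _ _ ≤ _
    linarith

theorem le_cost_add {C : ℤ} (hC : ∀ a b, |P a b| ≤ C) (p : ℕ → EH) (f : VG → ℤ) {n : ℕ} {c : ℤ}
    (h : ∀ u, c ≤ cost G P p f n u) (m : ℕ) (v : VG) : c - m * C ≤ cost G P p f (n + m) v := by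
  induction m generalizing v with
  | zero => simpa using h v
  | succ m ih =>
    obtain ⟨a, rfl, h₁⟩ := exists_stepCost_eq hG P (cost G P p f (n + m)) (p (n + m)) v
    have h₂ := (abs_le.1 (hC a (p (n + m)))).1
    have h₃ := ih (G.src a)
    rw [← add_assoc]
    push_cast
    change _ ≤ stepCost _ _ _ _ _
    linarith

omit hG in
theorem DirGraph.Reach.cost_le {C : ℤ} (hC : ∀ a b, |P a b| ≤ C) (p : ℕ → EH) (f : VG → ℤ)
    {m n : ℕ} {v w : VG} (h : G.Reach m v w) :
    cost G P p f (n + m) w ≤ cost G P p f n v + m * C := by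
  induction m generalizing n v with
  | zero =>
    obtain rfl : v = w := h
    simp
  | succ m ih =>
    obtain ⟨a, rfl, h⟩ := h
    have h₁ := stepCost_le (G := G) (P := P) (cost G P p f n) (p n) a
    have h₂ := (abs_le.1 (hC a (p n))).2
    have h₃ := ih (n := n + 1) h
    have h₄ : cost G P p f (n + 1) (G.tgt a) = stepCost G P (cost G P p f n) (p n) (G.tgt a) := rfl
    rw [show n + (m + 1) = n + 1 + m by ring]
    push_cast
    linarith

end Step

theorem cost_le_sum [Finite EG] (p : ℕ → EH) (f : VG → ℤ) {q : ℕ → EG} (hq : IsInfWalk G q)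
    (n : ℕ) : cost G P p f n (G.src (q n)) ≤
      f (G.src (q 0)) + ∑ i ∈ Finset.range n, P (q i) (p i) := by
  induction n with
  | zero => simp [cost]
  | succ n ih =>
    rw [Finset.sum_range_succ, ← hq n]
    have := stepCost_le (G := G) (P := P) (cost G P p f n) (p n) (q n)
    change stepCost _ _ _ _ _ ≤ _
    linarith

/-- There is an infinite walk in `G` all of whose initial segments are optimal against `p`. -/
theorem exists_optimal_response [Finite EG] [Nonempty VG] (hG : Function.Surjective G.tgt)
    (P : EG → EH → ℤ) (p : ℕ → EH) (f : VG → ℤ) :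
    ∃ q, IsInfWalk G q ∧ ∀ n, cost G P p f n (G.src (q n)) =
      f (G.src (q 0)) + ∑ i ∈ Finset.range n, P (q i) (p i) := by
  let W : ℕ → Set (ℕ → EG) := fun n =>
    {q | (∀ m < n, cost G P p f (m + 1) (G.tgt (q m)) =
      cost G P p f m (G.src (q m)) + P (q m) (p m)) ∧ ∀ m, m + 1 < n → G.tgt (q m) = G.src (q (m + 1))}
  let : TopologicalSpace EG := ⊥
  have : DiscreteTopology EG := ⟨rfl⟩
  have : Nonempty EG := (hG (Classical.arbitrary VG)).nonempty
  have hfin : ∀ n v, ∃ q ∈ W n, ∀ m, m + 1 = n → G.tgt (q m) = v := by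
    intro n
    induction n with
    | zero => exact fun v => ⟨fun _ => Classical.arbitrary EG, by simp [W], by simp⟩
    | succ n ih =>
      intro v
      obtain ⟨a, ha, hav⟩ := exists_stepCost_eq hG P (cost G P p f n) (p n) v
      obtain ⟨q, ⟨hq₁, hq₂⟩, hq₃⟩ := ih (G.src a)
      have hne : ∀ m < n, Function.update q n a m = q m := fun m hm =>
        Function.update_of_ne hm.ne _ _
      refine ⟨Function.update q n a, ⟨fun m hm => ?_, fun m hm => ?_⟩, fun m hm => ?_⟩
      · rcases Nat.lt_succ_iff_lt_or_eq.1 hm with hm | rfl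
        · rw [hne m hm, hq₁ m hm]
        · rw [Function.update_self, ha]
          exact hav
      · rw [hne m (by omega)]
        rcases Nat.lt_succ_iff_lt_or_eq.1 hm with hm | rfl
        · rw [hne _ hm, hq₂ m hm]
        · rw [Function.update_self, hq₃ m rfl]
      · obtain rfl : m = n := by omega
        rw [Function.update_self, ha]
  have hcl : ∀ n, IsClosed (W n) := by
    intro n
    simp only [W, Set.ofPred_and, Set.ofPred_forall]
    have hcont : ∀ m m' (s : Set (EG × EG)), IsClosed {q : ℕ → EG | (q m, q m') ∈ s} :=
      fun m m' s => (isClosed_discrete s).preimage (by fun_prop)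
    refine IsClosed.inter ?_ ?_
    · exact isClosed_iInter fun m => isClosed_iInter fun _ => hcont m m
        {e | cost G P p f (m + 1) (G.tgt e.1) = cost G P p f m (G.src e.1) + P e.1 (p m)}
    · exact isClosed_iInter fun m => isClosed_iInter fun _ => hcont m (m + 1)
        {e | G.tgt e.1 = G.src e.2}
  obtain ⟨q, hq⟩ := IsCompact.nonempty_iInter_of_sequence_nonempty_isCompact_isClosed W
    (fun n q hq => ⟨fun m hm => hq.1 m (by omega), fun m hm => hq.2 m (by omega)⟩)
    (fun n => let ⟨q, hq, _⟩ := hfin n (Classical.arbitrary VG); ⟨q, hq⟩)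
    (hcl 0).isCompact hcl
  rw [Set.mem_iInter] at hq
  have hwalk : IsInfWalk G q := fun n => (hq (n + 2)).2 n (by omega)
  refine ⟨q, hwalk, fun n => ?_⟩
  induction n with
  | zero => simp [cost]
  | succ n ih =>
    rw [Finset.sum_range_succ, ← hwalk n, (hq (n + 1)).1 n (by omega), ih]
    ring

theorem exists_cost_sub_le [Finite VG] [Finite EG] (hG : G.Primitive) {C : ℕ}
    (hC : ∀ a b, |P a b| ≤ C) : ∃ B : ℕ, ∀ (p : ℕ → EH) (n : ℕ) (v v' : VG),
      |cost G P p 0 n v - cost G P p 0 n v'| ≤ B := by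
  obtain ⟨N, hN⟩ := hG.exists_forall_reach
  have := hG.nonempty
  have ht := hG.1.tgt_surjective
  refine ⟨2 * (N * C), fun p n => ?_⟩
  suffices ∃ c : ℤ, ∀ v, |cost G P p 0 n v - c| ≤ N * C by
    obtain ⟨c, hc⟩ := this
    intro v v'
    have h := abs_le.1 (hc v)
    have h' := abs_le.1 (hc v')
    rw [abs_le]
    push_cast
    constructor <;> linarith
  rcases le_total n N with hn | hn
  · refine ⟨0, fun v => ?_⟩
    have h₁ := cost_add_le (n := 0) (c := 0) ht hC p 0 (fun u => le_rfl) n v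
    have h₂ := le_cost_add (n := 0) (c := 0) ht hC p 0 (fun u => le_rfl) n v
    have h₃ : (n : ℤ) * C ≤ N * C := by gcongr
    rw [zero_add] at h₁ h₂
    rw [abs_le]
    constructor <;> linarith
  · obtain ⟨m, rfl⟩ := Nat.exists_eq_add_of_le' hn
    obtain ⟨u, hu⟩ := Finite.exists_min (cost G P p 0 m)
    refine ⟨cost G P p 0 m u, fun v => ?_⟩
    have h₁ := (hN u v).cost_le hC p 0 (n := m)
    have h₂ := le_cost_add ht hC p 0 hu N v
    rw [abs_le]
    constructor <;> linarith

end Cost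

section Value

variable {VG EG VH EH : Type} {G : DirGraph VG EG} {H : DirGraph VH EH}

theorem payoffSum_eq_sum_range (P : EG → EH → ℤ) {n : ℕ} {l : List EG} {l' : List EH} {q : ℕ → EG}
    {p : ℕ → EH} (hl : l.length = n) (hl' : l'.length = n)
    (hq : ∀ i (h : i < l.length), l[i] = q i) (hp : ∀ i (h : i < l'.length), l'[i] = p i) :
    payoffSum P l l' = ∑ i ∈ Finset.range n, P (q i) (p i) := by
  have : List.zipWith P l l' = List.ofFn fun i : Fin n => P (q i) (p i) := by
    refine List.ext_getElem (by simp [hl, hl']) fun i h₁ h₂ => ?_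
    simp [hq, hp]
  rw [payoffSum, this, List.sum_ofFn, Finset.sum_range]

theorem DirGraph.finite_walks [Finite EG] (G : DirGraph VG EG) (n : ℕ) : (G.walks n).Finite :=
  (List.finite_length_eq EG n).subset fun _ h => h.1

variable [Finite EG] [Finite EH]

theorem exists_forall_Vn_le [Nonempty VH] (hH : Function.Surjective H.src)
    (P : EG → EH → ℤ) (n : ℕ) : ∃ p, IsInfWalk H p ∧ ∀ q, IsInfWalk G q →
      Vn G H P n ≤ ∑ i ∈ Finset.range n, P (q i) (p i) := by
  obtain ⟨p₀, hp₀, -⟩ := exists_isInfWalk hH (Classical.arbitrary VH)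
  have hne : (H.walks n).Nonempty := ⟨_, hp₀.ofFn_mem_walks n⟩
  obtain ⟨l, hl, hlV⟩ := (hne.image fun p =>
    sInf ((fun q => payoffSum P q p) '' G.walks n)).csSup_mem ((H.finite_walks n).image _)
  obtain ⟨p, hp, hpl⟩ : ∃ p, IsInfWalk H p ∧ ∀ i (h : i < l.length), l[i] = p i := by
    rcases l with _ | ⟨a, l⟩
    · exact ⟨p₀, hp₀, fun i h => absurd h (by simp)⟩
    · obtain ⟨p, hp, -, h⟩ := exists_isInfWalk_extending hH _ hl.2 (H.src a) (by simp)
      exact ⟨p, hp, h⟩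
  refine ⟨p, hp, fun q hq => ?_⟩
  rw [Vn, ← hlV, ← payoffSum_eq_sum_range P (List.length_ofFn (f := fun i : Fin n => q i)) hl.1
    (by simp) hpl]
  exact csInf_le ((G.finite_walks n).image _).bddBelow ⟨_, hq.ofFn_mem_walks n, rfl⟩

theorem exists_sum_le_Vn [Nonempty VG] (hG : Function.Surjective G.src) (P : EG → EH → ℤ) (n : ℕ)
    {p : ℕ → EH} (hp : IsInfWalk H p) : ∃ q, IsInfWalk G q ∧
      ∑ i ∈ Finset.range n, P (q i) (p i) ≤ Vn G H P n := by
  obtain ⟨q₀, hq₀, -⟩ := exists_isInfWalk hG (Classical.arbitrary VG)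
  have hne : (G.walks n).Nonempty := ⟨_, hq₀.ofFn_mem_walks n⟩
  obtain ⟨l, hl, hlV⟩ := (hne.image fun q =>
    payoffSum P q (List.ofFn fun i : Fin n => p i)).csInf_mem ((G.finite_walks n).image _)
  obtain ⟨q, hq, hql⟩ : ∃ q, IsInfWalk G q ∧ ∀ i (h : i < l.length), l[i] = q i := by
    rcases l with _ | ⟨a, l⟩
    · exact ⟨q₀, hq₀, fun i h => absurd h (by simp)⟩
    · obtain ⟨q, hq, -, h⟩ := exists_isInfWalk_extending hG _ hl.2 (G.src a) (by simp)
      exact ⟨q, hq, h⟩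
  refine ⟨q, hq, ?_⟩
  rw [← payoffSum_eq_sum_range P hl.1 (List.length_ofFn (f := fun i : Fin n => p i)) hql (by simp)]
  simp only at hlV
  rw [hlV]
  exact le_csSup ((H.finite_walks n).image _).bddAbove ⟨_, hp.ofFn_mem_walks n, rfl⟩

end Value

section Equilibrium

variable {VG EG VH EH : Type}

/-- The graph whose walks follow a walk in `H` together with the evolution of the cost vector,
normalized to vanish at `v₀` and restricted to entries bounded by `B`. -/
noncomputable def costGraph (G : DirGraph VG EG) (H : DirGraph VH EH) (P : EG → EH → ℤ) (v₀ : VG)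
    (B : ℕ) : DirGraph (VH × {f : VG → ℤ // ∀ v, |f v| ≤ B})
      {t : {f : VG → ℤ // ∀ v, |f v| ≤ B} × EH × {f : VG → ℤ // ∀ v, |f v| ≤ B} //
        ∀ v, t.2.2.1 v = stepCost G P t.1.1 t.2.1 v - stepCost G P t.1.1 t.2.1 v₀} where
  src t := (H.src t.1.2.1, t.1.1)
  tgt t := (H.tgt t.1.2.1, t.1.2.2)

variable {G : DirGraph VG EG} {H : DirGraph VH EH} {P : EG → EH → ℤ}

theorem cost_eq_of_isInfWalk_costGraph [Finite EG] (hG : Function.Surjective G.tgt) {v₀ : VG}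
    {B : ℕ} {x : ℕ → _} (hx : IsInfWalk (costGraph G H P v₀ B) x) (n : ℕ) (v : VG) :
    cost G P (fun n => (x n).1.2.1) (x 0).1.1.1 n v = (x n).1.1.1 v +
      ∑ i ∈ Finset.range n, stepCost G P (x i).1.1.1 (x i).1.2.1 v₀ := by
  induction n generalizing v with
  | zero => simp [cost]
  | succ n ih =>
    have h₁ : (x (n + 1)).1.1 = (x n).1.2.2 := (congrArg Prod.snd (hx n)).symm
    rw [Finset.sum_range_succ, h₁, (x n).2 v, cost, funext ih, stepCost_add_const hG]
    ring

theorem isInfWalk_costGraph_of_cost [Finite EG] (hG : Function.Surjective G.tgt) (v₀ : VG) {B : ℕ}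
    (hB : ∀ (p : ℕ → EH) (n : ℕ) (v v' : VG), |cost G P p 0 n v - cost G P p 0 n v'| ≤ B)
    {p : ℕ → EH} (hp : IsInfWalk H p) :
    ∃ x, IsInfWalk (costGraph G H P v₀ B) x ∧
      ∀ n, cost G P p 0 n v₀ =
        ∑ i ∈ Finset.range n, stepCost G P (x i).1.1.1 (x i).1.2.1 v₀ := by
  let f : ℕ → {f : VG → ℤ // ∀ v, |f v| ≤ B} := fun n =>
    ⟨fun v => cost G P p 0 n v - cost G P p 0 n v₀, fun v => hB p n v v₀⟩
  have hstep : ∀ n v, stepCost G P (f n).1 (p n) v = cost G P p 0 (n + 1) v - cost G P p 0 n v₀ :=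
    fun n v => stepCost_add_const hG (cost G P p 0 n) (-cost G P p 0 n v₀) (p n) v
  refine ⟨fun n => ⟨(f n, p n, f (n + 1)), fun v => ?_⟩, fun n => ?_, fun n => ?_⟩
  · simp only [hstep]
    simp [f]
  · exact Prod.ext (hp n) rfl
  · simp only [hstep]
    rw [Finset.sum_range_sub (fun n => cost G P p 0 n v₀)]
    simp [cost]

/-- Some periodic walk in `H` forces the maximal asymptotic growth rate of the cost. -/
theorem exists_periodic_maximal_cost [Finite VG] [Finite EG] [Finite VH] [Finite EH]
    (hG : G.Primitive) (hH : H.Primitive) (P : EG → EH → ℤ) :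
    ∃ (μ : ℝ) (k : ℕ) (p : ℕ → EH) (f : VG → ℤ), 0 < k ∧ IsInfWalk H p ∧
      (∀ n, p (n + k) = p n) ∧
      (∀ n v, (cost G P p f (n + k) v : ℝ) = cost G P p f n v + k * μ) ∧
      ∃ K : ℝ, ∀ p', IsInfWalk H p' → ∀ (n : ℕ) v, (cost G P p' 0 n v : ℝ) ≤ n * μ + K := by
  obtain ⟨C, hC⟩ : ∃ C : ℕ, ∀ a b, |P a b| ≤ C := by
    obtain ⟨C, hC⟩ := (Set.finite_range fun ab : EG × EH => (P ab.1 ab.2).natAbs).bddAbove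
    refine ⟨C, fun a b => ?_⟩
    rw [Int.abs_eq_natAbs]
    exact_mod_cast hC ⟨(a, b), rfl⟩
  have ht := hG.1.tgt_surjective
  obtain ⟨v₀⟩ := hG.nonempty
  obtain ⟨w₀⟩ := hH.nonempty
  obtain ⟨B, hB⟩ := exists_cost_sub_le hG hC
  have hfin : Finite {f : VG → ℤ // ∀ v, |f v| ≤ B} := by
    refine Set.Finite.to_subtype (s := {f : VG → ℤ | ∀ v, |f v| ≤ B}) ?_
    refine (Set.Finite.pi fun _ : VG => Set.finite_Icc (-(B : ℤ)) B).subset fun f hf v _ => ?_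
    exact abs_le.1 (hf v)
  obtain ⟨p₀, hp₀, -⟩ := exists_isInfWalk hH.1.src_surjective w₀
  obtain ⟨x₀, hx₀, -⟩ := isInfWalk_costGraph_of_cost ht v₀ hB hp₀
  obtain ⟨μ, k, x, hk, hx, hxk, hμ, K, hK⟩ := exists_periodic_maximal_mean (costGraph G H P v₀ B)
    (fun t => stepCost G P t.1.1.1 t.1.2.1 v₀) (B + C) (fun t => by
      obtain ⟨a, -, h⟩ := exists_stepCost_eq ht P t.1.1.1 t.1.2.1 v₀
      rw [h]
      push_cast
      exact (abs_add_le _ _).trans (add_le_add (t.1.1.2 _) (hC _ _))) ⟨x₀, hx₀⟩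
  have hcost := cost_eq_of_isInfWalk_costGraph ht hx
  refine ⟨μ, k, fun n => (x n).1.2.1, (x 0).1.1.1, hk, fun n => congrArg Prod.fst (hx n),
    fun n => by simp only [hxk], fun n v => ?_, K + B, fun p' hp' n v => ?_⟩
  · have hper : Function.Periodic (fun n => stepCost G P (x n).1.1.1 (x n).1.2.1 v₀) k :=
      fun n => by simp only [hxk]
    have hsum : ∀ n, ∑ i ∈ Finset.range k, stepCost G P (x (n + i)).1.1.1 (x (n + i)).1.2.1 v₀ =
        ∑ i ∈ Finset.range k, stepCost G P (x i).1.1.1 (x i).1.2.1 v₀ := fun n => by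
      induction n with
      | zero => simp
      | succ n ih =>
        rw [← ih]
        have h₁ := Finset.sum_range_succ'
          (fun i => stepCost G P (x (n + i)).1.1.1 (x (n + i)).1.2.1 v₀) k
        have h₂ := Finset.sum_range_succ
          (fun i => stepCost G P (x (n + i)).1.1.1 (x (n + i)).1.2.1 v₀) k
        have h₃ := hper n
        simp only [add_zero, add_right_comm n, ← add_assoc] at h₁ h₂ h₃ ⊢
        linarith
    rw [hcost, hcost, hxk, Finset.sum_range_add, hsum, ← hμ]
    push_cast
    ring
  · obtain ⟨y, hy, hyc⟩ := isInfWalk_costGraph_of_cost ht v₀ hB hp'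
    have h₁ := hK y hy n
    rw [← hyc] at h₁
    have h₂ : ((cost G P p' 0 n v - cost G P p' 0 n v₀ : ℤ) : ℝ) ≤ B := by
      exact_mod_cast (abs_le.1 (hB p' n v v₀)).2
    push_cast at h₂
    linarith

theorem tendsto_div_of_abs_sub_le {u : ℕ → ℝ} {μ D : ℝ} (h : ∀ n : ℕ, |u n - n * μ| ≤ D) :
    Tendsto (fun n : ℕ => u n / n) atTop (nhds μ) := by
  rw [tendsto_iff_dist_tendsto_zero]
  refine squeeze_zero' (.of_forall fun _ => dist_nonneg) ?_
    (tendsto_const_div_atTop_nhds_zero_nat D)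
  filter_upwards [eventually_gt_atTop 0] with n hn
  have hn' : (0 : ℝ) < n := by exact_mod_cast hn
  rw [Real.dist_eq, div_sub' hn'.ne', abs_div, abs_of_pos hn']
  gcongr
  exact h n

theorem abs_sum_div_le {x : ℕ → ℤ} {C : ℝ} (hx : ∀ n, |(x n : ℝ)| ≤ C) (n : ℕ) :
    |((∑ i ∈ Finset.range n, x i : ℤ) : ℝ) / n| ≤ C := by
  have hC : 0 ≤ C := (abs_nonneg _).trans (hx 0)
  rw [abs_div, Nat.abs_cast]
  refine div_le_of_le_mul₀ (by positivity) hC ?_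
  push_cast
  refine (Finset.abs_sum_le_sum_abs _ _).trans ?_
  simpa [mul_comm] using Finset.sum_le_card_nsmul (Finset.range n) (fun i => |(x i : ℝ)|) C
    fun i _ => hx i

theorem le_liminf_sum_div {x : ℕ → ℤ} {C : ℝ} (hx : ∀ n, |(x n : ℝ)| ≤ C) {μ K : ℝ}
    (h : ∀ n : ℕ, n * μ - K ≤ ((∑ i ∈ Finset.range n, x i : ℤ) : ℝ)) :
    μ ≤ liminf (fun n : ℕ => ((∑ i ∈ Finset.range n, x i : ℤ) : ℝ) / n) atTop := by
  have hlim : Tendsto (fun n : ℕ => (n * μ - K) / n) atTop (nhds μ) :=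
    tendsto_div_of_abs_sub_le (D := |K|) fun n => by simp
  rw [← hlim.liminf_eq]
  refine liminf_le_liminf
    (.of_forall fun n => div_le_div_of_nonneg_right (h n) n.cast_nonneg) hlim.isBoundedUnder_ge ?_
  exact (isBoundedUnder_of ⟨C, fun n => (abs_le.1 (abs_sum_div_le hx n)).2⟩).isCoboundedUnder_ge

theorem limsup_sum_div_le {x : ℕ → ℤ} {C : ℝ} (hx : ∀ n, |(x n : ℝ)| ≤ C) {μ K : ℝ}
    (h : ∀ n : ℕ, ((∑ i ∈ Finset.range n, x i : ℤ) : ℝ) ≤ n * μ + K) :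
    limsup (fun n : ℕ => ((∑ i ∈ Finset.range n, x i : ℤ) : ℝ) / n) atTop ≤ μ := by
  have hlim : Tendsto (fun n : ℕ => (n * μ + K) / n) atTop (nhds μ) :=
    tendsto_div_of_abs_sub_le (D := |K|) fun n => by simp
  rw [← hlim.limsup_eq]
  refine limsup_le_limsup
    (.of_forall fun n => div_le_div_of_nonneg_right (h n) n.cast_nonneg) ?_ hlim.isBoundedUnder_le
  exact (isBoundedUnder_of ⟨-C, fun n => (abs_le.1 (abs_sum_div_le hx n)).1⟩).isCoboundedUnder_le

/-- Against a periodic `p` whose costs grow by exactly `k * μ` per period there is a periodic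
response of mean exactly `μ`. -/
theorem exists_periodic_response [Finite VG] [Finite EG] [Nonempty VG]
    (hG : Function.Surjective G.tgt) {p : ℕ → EH} {f : VG → ℤ} {k : ℕ} {μ : ℝ} (hk : 0 < k)
    (hpk : ∀ n, p (n + k) = p n)
    (hcost : ∀ n v, (cost G P p f (n + k) v : ℝ) = cost G P p f n v + k * μ) :
    ∃ (q : ℕ → EG) (j : ℕ), 0 < j ∧ IsInfWalk G q ∧ (∀ n, q (n + j * k) = q n) ∧
      ((∑ i ∈ Finset.range (j * k), P (q i) (p i) : ℤ) : ℝ) = (j * k : ℕ) * μ := by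
  obtain ⟨q, hq, hqc⟩ := exists_optimal_response hG P p f
  obtain ⟨i, j, hj, -, hij⟩ := exists_src_eq (fun n => q (n * k)) G
  rw [add_mul] at hij
  have hp : ∀ m n, p (m * k + n) = p n := fun m n => by
    have := Function.Periodic.nat_mul (f := p) hpk m n
    rwa [add_comm]
  have hcost' : ∀ m n v, (cost G P p f (n + m * k) v : ℝ) = cost G P p f n v + (m * k : ℕ) * μ := by
    intro m n v
    induction m with
    | zero => simp
    | succ m ih =>
      rw [Nat.succ_mul, ← add_assoc, hcost, ih]
      push_cast
      ring
  refine ⟨_, j, hj, hq.loop (Nat.mul_pos hj hk) hij, fun n => by simp, ?_⟩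
  have hsum : ∑ m ∈ Finset.range (j * k), P (q (i * k + m % (j * k))) (p m) =
      ∑ m ∈ Finset.range (j * k), P (q (i * k + m)) (p (i * k + m)) :=
    Finset.sum_congr rfl fun m hm => by rw [hp, Nat.mod_eq_of_lt (Finset.mem_range.1 hm)]
  have h₁ := hqc (i * k)
  have h₂ := hqc (i * k + j * k)
  have h₃ := hcost' j (i * k) (G.src (q (i * k)))
  rw [Finset.sum_range_add, ← hij] at h₂
  rw [hsum, ← add_right_inj (cost G P p f (i * k) (G.src (q (i * k))) : ℝ), ← h₃, h₂, h₁]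
  push_cast
  ring

end Equilibrium

/-- The Nash equilibrium of the non-alternating mean payoff game is attained by
periodic strategies. -/
theorem periodic_nash_equilibrium {VG EG VH EH : Type} [Fintype VG] [Fintype EG]
    [Fintype VH] [Fintype EH] (G : DirGraph VG EG) (H : DirGraph VH EH)
    (hG : G.Primitive) (hH : H.Primitive) (P : EG → EH → ℤ) (V : ℝ)
    (hV : Filter.Tendsto (fun n : ℕ => (Vn G H P n : ℝ) / n) Filter.atTop (nhds V)) :
    ∃ (p : ℕ → EH) (q : ℕ → EG) (k : ℕ), IsInfWalk H p ∧ IsInfWalk G q ∧ 0 < k ∧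
      (∀ n : ℕ, p (n + k) = p n) ∧ (∀ n : ℕ, q (n + k) = q n) ∧
      Filter.Tendsto
        (fun n : ℕ => ((∑ i ∈ Finset.range n, P (q i) (p i) : ℤ) : ℝ) / n)
        Filter.atTop (nhds V) ∧
      (∀ q' : ℕ → EG, IsInfWalk G q' →
        V ≤ Filter.liminf
          (fun n : ℕ => ((∑ i ∈ Finset.range n, P (q' i) (p i) : ℤ) : ℝ) / n)
          Filter.atTop) ∧
      (∀ p' : ℕ → EH, IsInfWalk H p' → ∃ q' : ℕ → EG, IsInfWalk G q' ∧
        Filter.limsup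
          (fun n : ℕ => ((∑ i ∈ Finset.range n, P (q' i) (p' i) : ℤ) : ℝ) / n)
          Filter.atTop ≤ V) := by
  obtain ⟨μ, k, p, f, hk, hp, hpk, hcost, K, hK⟩ := exists_periodic_maximal_cost hG hH P
  have := hG.nonempty
  have := hH.nonempty
  have ht := hG.1.tgt_surjective
  obtain ⟨C, hC⟩ : ∃ C : ℝ, ∀ a b, |(P a b : ℝ)| ≤ C := by
    obtain ⟨C, hC⟩ := (Set.finite_range fun ab : EG × EH => |(P ab.1 ab.2 : ℝ)|).bddAbove
    exact ⟨C, fun a b => hC ⟨(a, b), rfl⟩⟩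
  obtain ⟨L, hL⟩ : ∃ L : ℝ, ∀ q, IsInfWalk G q → ∀ n : ℕ,
      n * μ - L ≤ ((∑ i ∈ Finset.range n, P (q i) (p i) : ℤ) : ℝ) := by
    obtain ⟨F, hF⟩ := (Set.finite_range fun v => (f v : ℝ)).bddAbove
    obtain ⟨D, hD⟩ := ((Set.finite_Iio k).prod (Set.finite_univ (α := VG))).image
      (fun s => s.1 * μ - (cost G P p f s.1 s.2 : ℝ)) |>.bddAbove
    have hlow : ∀ (n : ℕ) v, n * μ - cost G P p f n v ≤ D := fun n v => by
      have hper : Function.Periodic (fun n : ℕ => n * μ - (cost G P p f n v : ℝ)) k := fun n => by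
        simp only [hcost]
        push_cast
        ring
      rw [← hper.map_mod_nat n]
      exact hD ⟨(n % k, v), ⟨Nat.mod_lt n hk, trivial⟩, rfl⟩
    refine ⟨D + F, fun q hq n => ?_⟩
    have h₁ : (cost G P p f n (G.src (q n)) : ℝ) ≤
        f (G.src (q 0)) + ((∑ i ∈ Finset.range n, P (q i) (p i) : ℤ) : ℝ) := by
      exact_mod_cast cost_le_sum p f hq n
    have h₂ : (f (G.src (q 0)) : ℝ) ≤ F := hF ⟨_, rfl⟩
    linarith [hlow n (G.src (q n))]
  have hU : ∀ p', IsInfWalk H p' → ∃ q', IsInfWalk G q' ∧ ∀ n : ℕ,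
      ((∑ i ∈ Finset.range n, P (q' i) (p' i) : ℤ) : ℝ) ≤ n * μ + K := by
    intro p' hp'
    obtain ⟨q', hq', hq'c⟩ := exists_optimal_response ht P p' 0
    refine ⟨q', hq', fun n => ?_⟩
    have := hK p' hp' n (G.src (q' n))
    rwa [hq'c, Pi.zero_apply, zero_add] at this
  obtain rfl : V = μ := by
    refine tendsto_nhds_unique hV (tendsto_div_of_abs_sub_le (D := max K L) fun n => ?_)
    obtain ⟨p₁, hp₁, h₁⟩ := exists_forall_Vn_le (G := G) hH.1.src_surjective P n
    obtain ⟨q₁, hq₁, h₁'⟩ := hU p₁ hp₁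
    obtain ⟨q₂, hq₂, h₂⟩ := exists_sum_le_Vn (H := H) hG.1.src_surjective P n hp
    have h₃ : (Vn G H P n : ℝ) ≤ n * μ + K := (Int.cast_le.2 (h₁ q₁ hq₁)).trans (h₁' n)
    have h₄ : n * μ - L ≤ (Vn G H P n : ℝ) := (hL q₂ hq₂ n).trans (Int.cast_le.2 h₂)
    rw [abs_le]
    constructor <;> linarith [le_max_left K L, le_max_right K L]
  obtain ⟨q, j, hj, hq, hqk, hqs⟩ := exists_periodic_response ht hk hpk hcost
  have hpj : ∀ n, p (n + j * k) = p n := Function.Periodic.nat_mul (f := p) hpk j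
  have hjk : 0 < j * k := Nat.mul_pos hj hk
  obtain ⟨D, hD⟩ := exists_abs_sum_sub_le_of_periodic hjk (fun n => by rw [hqk, hpj]) hqs
  refine ⟨p, q, j * k, hp, hq, hjk, hpj, hqk, tendsto_div_of_abs_sub_le hD,
    fun q' hq' => le_liminf_sum_div (fun n => hC _ _) (hL q' hq'), fun p' hp' => ?_⟩
  obtain ⟨q', hq', h⟩ := hU p' hp'
  exact ⟨q', hq', limsup_sum_div_le (fun n => hC _ _) h⟩
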